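/- Assume (H1), (H2) and (H3). Then there exists α* > 0 such that for each α ∈ (0,α*] there exist ρ ∈ Λ, T̃ > 0 and a constant C > 0 with the following property: whenever g : Θ → [0,∞), φ̃ : [0,∞) → [0,∞) and a Borel measurable f : X → [0,∞] satisfy W_{ρ_{γα}}(P_t^θ(u,·), P_t^{θ₀}(u,·)) ≤ φ̃(t)·f(u)·g(θ) for all θ ∈ Θ, t ≥ 0 and u ∈ X (with γ the constant from (H1) and ρ the above element of Λ), then W_{ρ_α}(μ_θ, μ_{θ₀}) ≤ C · φ̃(T̃) · g(θ) · ∫_X f(u) μ_{θ₀}(du) for every θ ∈ Θ. -/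

import Mathlib

open MeasureTheory ENNReal Filter

noncomputable section

/-- A coupling of two Borel probability measures: a measure on the product whose
marginals are the given measures. -/
def IsCoupling {X : Type*} [MeasurableSpace X] (μ ν : Measure X)
    (Γ : Measure (X × X)) : Prop :=
  Γ.map Prod.fst = μ ∧ Γ.map Prod.snd = ν

/-- The Wasserstein-like extension of a distance-like function `ρ` to probability
measures: the infimum over couplings of the integral of `ρ`. -/
noncomputable def wassLike {X : Type*} [MeasurableSpace X] (ρ : X → X → ℝ)
    (μ ν : Measure X) : ℝ≥0∞ :=
  ⨅ (Γ : Measure (X × X)) (_ : IsProbabilityMeasure Γ) (_ : IsCoupling μ ν Γ),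
    ∫⁻ p, ENNReal.ofReal (ρ p.1 p.2) ∂Γ

/-- A distance-like function: nonnegative, symmetric, lower semicontinuous, and
vanishing exactly on the diagonal. -/
def DistanceLike {X : Type*} [TopologicalSpace X] (ρ : X → X → ℝ) : Prop :=
  (∀ u v, 0 ≤ ρ u v) ∧ (∀ u v, ρ u v = ρ v u) ∧
    LowerSemicontinuous (fun p : X × X => ρ p.1 p.2) ∧
    (∀ u v, ρ u v = 0 ↔ u = v)

/-- A Markov kernel given as a measurable family of probability measures. -/
def IsMarkovKernelFun {X : Type*} [MeasurableSpace X] (P : X → Measure X) : Prop :=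
  Measurable P ∧ ∀ u, IsProbabilityMeasure (P u)

/-- The weighted distance-like function `ρ_a(u,v) = ρ(u,v)^{1/2} exp(a‖u‖² + a‖v‖²)`. -/
noncomputable def expWeight {X : Type*} [NormedAddCommGroup X]
    (ρ : X → X → ℝ) (a : ℝ) (u v : X) : ℝ :=
  Real.sqrt (ρ u v) * Real.exp (a * ‖u‖ ^ 2 + a * ‖v‖ ^ 2)

section Transport

lemma wassLike_le {X : Type*} [MeasurableSpace X] {c : X → X → ℝ} {μ ν : Measure X}
    {Γ : Measure (X × X)} (hΓ : IsProbabilityMeasure Γ) (h : IsCoupling μ ν Γ) :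
    wassLike c μ ν ≤ ∫⁻ p, ENNReal.ofReal (c p.1 p.2) ∂Γ :=
  iInf_le_of_le Γ <| iInf_le_of_le hΓ <| iInf_le _ h

lemma exists_coupling_of_wassLike_lt {X : Type*} [MeasurableSpace X] {c : X → X → ℝ}
    {μ ν : Measure X} {r : ℝ≥0∞} (h : wassLike c μ ν < r) :
    ∃ Γ : Measure (X × X), IsProbabilityMeasure Γ ∧ IsCoupling μ ν Γ ∧
      ∫⁻ p, ENNReal.ofReal (c p.1 p.2) ∂Γ < r := by
  simp only [wassLike, iInf_lt_iff] at h
  obtain ⟨Γ, h1, h2, h3⟩ := h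
  exact ⟨Γ, h1, h2, h3⟩

lemma wassLike_mono {X : Type*} [MeasurableSpace X] {c d : X → X → ℝ} {μ ν : Measure X}
    (h : ∀ u v, c u v ≤ d u v) : wassLike c μ ν ≤ wassLike d μ ν :=
  le_iInf fun _ ↦ le_iInf fun hΓ ↦ le_iInf fun hc ↦ (wassLike_le hΓ hc).trans <|
    lintegral_mono fun _ ↦ ENNReal.ofReal_le_ofReal (h _ _)

lemma wassLike_const_mul_le {X : Type*} [MeasurableSpace X] {c : X → X → ℝ} {μ ν : Measure X}
    {A : ℝ} (hA : 0 < A) :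
    wassLike (fun u v ↦ A * c u v) μ ν ≤ ENNReal.ofReal A * wassLike c μ ν := by
  have hA0 : ENNReal.ofReal A ≠ 0 := by simpa using hA
  simp only [wassLike]
  simp_rw [ENNReal.mul_iInf_of_ne hA0 ENNReal.ofReal_ne_top]
  refine iInf_mono fun Γ ↦ iInf_mono fun _ ↦ iInf_mono fun _ ↦ ?_
  simp_rw [ENNReal.ofReal_mul hA.le]
  rw [lintegral_const_mul' _ _ ENNReal.ofReal_ne_top]

lemma wassLike_le_add {X : Type*} [MeasurableSpace X] {c d : X → X → ℝ} {μ ν : Measure X}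
    {G H : X → ℝ≥0∞} (hG : Measurable G) (hH : Measurable H)
    (h : ∀ u v, ENNReal.ofReal (c u v) ≤ ENNReal.ofReal (d u v) + (G u + H v)) :
    wassLike c μ ν ≤ wassLike d μ ν + (∫⁻ u, G u ∂μ + ∫⁻ v, H v ∂ν) := by
  conv_rhs => rw [wassLike]
  simp_rw [ENNReal.iInf_add]
  refine le_iInf fun Γ ↦ le_iInf fun hΓ ↦ le_iInf fun hc ↦ (wassLike_le hΓ hc).trans ?_
  rw [← hc.1, ← hc.2, lintegral_map hG measurable_fst, lintegral_map hH measurable_snd,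
    ← lintegral_add_left (by fun_prop), ← lintegral_add_right _ (by fun_prop)]
  exact lintegral_mono fun p ↦ h _ _

lemma wassLike_self {X : Type*} [MeasurableSpace X] {c : X → X → ℝ} (μ : Measure X)
    [IsProbabilityMeasure μ] (hc : Measurable fun p : X × X ↦ c p.1 p.2)
    (h : ∀ u, c u u ≤ 0) : wassLike c μ μ = 0 := by
  have hm : Measurable fun u : X ↦ (u, u) := by fun_prop
  refine le_antisymm ((wassLike_le (Γ := μ.map fun u ↦ (u, u))
    (Measure.isProbabilityMeasure_map hm.aemeasurable) ⟨?_, ?_⟩).trans ?_) zero_le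
  · rw [Measure.map_map measurable_fst hm]; exact Measure.map_id
  · rw [Measure.map_map measurable_snd hm]; exact Measure.map_id
  · rw [lintegral_map hc.ennreal_ofReal hm]
    simp [ENNReal.ofReal_of_nonpos (h _)]

lemma wassLike_dirac_le {X : Type*} [MeasurableSpace X] {c : X → X → ℝ}
    (hc : Measurable fun p : X × X ↦ c p.1 p.2) (u v : X) :
    wassLike c (Measure.dirac u) (Measure.dirac v) ≤ ENNReal.ofReal (c u v) := by
  refine (wassLike_le (Γ := Measure.dirac (u, v)) inferInstance ⟨?_, ?_⟩).trans ?_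
  · exact Measure.map_dirac' measurable_fst _
  · exact Measure.map_dirac' measurable_snd _
  · rw [lintegral_dirac' _ hc.ennreal_ofReal]

/-- Gluing of couplings along a common marginal. -/
lemma wassLike_triangle {X : Type*} [MeasurableSpace X] [StandardBorelSpace X]
    {a b c : X → X → ℝ} (ha : Measurable fun p : X × X ↦ a p.1 p.2)
    (hb : Measurable fun p : X × X ↦ b p.1 p.2) (hc : Measurable fun p : X × X ↦ c p.1 p.2)
    (h : ∀ u v w, ENNReal.ofReal (c u v) ≤ ENNReal.ofReal (a u w) + ENNReal.ofReal (b w v))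
    (μ κ ν : Measure X) :
    wassLike c μ ν ≤ wassLike a μ κ + wassLike b κ ν := by
  conv_rhs => rw [wassLike, wassLike]
  simp_rw [ENNReal.iInf_add, ENNReal.add_iInf]
  refine le_iInf fun Γ₁ ↦ le_iInf fun h₁ ↦ le_iInf fun hc₁ ↦
    le_iInf fun Γ₂ ↦ le_iInf fun h₂ ↦ le_iInf fun hc₂ ↦ ?_
  have : Nonempty X := (nonempty_of_isProbabilityMeasure Γ₁).map Prod.fst
  set η := Γ₂.condKernel.comap (Prod.snd : X × X → X) measurable_snd with hη
  set Γ := Γ₁.compProd η with hΓ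
  have hΓ₂ : (Γ.map fun q ↦ (q.1.2, q.2)) = Γ₂ := by
    refine Measure.ext_of_lintegral _ fun f hf ↦ ?_
    have hf' : Measurable fun x ↦ ∫⁻ y, f (x, y) ∂Γ₂.condKernel x :=
      hf.lintegral_kernel_prod_right'
    have key : Γ₁.map Prod.snd = Γ₂.fst := hc₁.2.trans hc₂.1.symm
    rw [lintegral_map hf (by fun_prop), hΓ, Measure.lintegral_compProd (by fun_prop)]
    simp only [hη, ProbabilityTheory.Kernel.comap_apply]
    rw [← lintegral_map (f := fun x ↦ ∫⁻ y, f (x, y) ∂Γ₂.condKernel x) hf' measurable_snd, key]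
    conv_rhs => rw [← Γ₂.disintegrate Γ₂.condKernel]
    rw [Measure.lintegral_compProd hf]
  have hΓ₁ : Γ.map Prod.fst = Γ₁ := Measure.fst_compProd _ _
  have hm : Measurable fun q : (X × X) × X ↦ (q.1.1, q.2) := by fun_prop
  refine (wassLike_le (Γ := Γ.map fun q ↦ (q.1.1, q.2))
    (Measure.isProbabilityMeasure_map hm.aemeasurable) ⟨?_, ?_⟩).trans ?_
  · rw [Measure.map_map measurable_fst hm, ← hc₁.1, ← hΓ₁,
      Measure.map_map measurable_fst measurable_fst]
    rfl
  · rw [Measure.map_map measurable_snd hm, ← hc₂.2, ← hΓ₂,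
      Measure.map_map measurable_snd (by fun_prop)]
    rfl
  · rw [lintegral_map hc.ennreal_ofReal hm]
    conv_rhs => rw [← hΓ₁, ← hΓ₂]
    rw [lintegral_map ha.ennreal_ofReal measurable_fst,
      lintegral_map hb.ennreal_ofReal (by fun_prop),
      ← lintegral_add_left (by fun_prop)]
    exact lintegral_mono fun q ↦ h _ _ _

/-- A nonnegative lower semicontinuous function is an increasing limit of bounded Lipschitz
functions. -/
lemma LowerSemicontinuous.exists_lipschitz_approx {Y : Type*} [PseudoMetricSpace Y] {c : Y → ℝ}
    (hc0 : ∀ y, 0 ≤ c y) (hc : LowerSemicontinuous c) :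
    ∃ g : ℕ → Y → ℝ, (∀ n y, 0 ≤ g n y) ∧ (∀ n y, g n y ≤ c y) ∧ (∀ n y, g n y ≤ n) ∧
      (∀ n : ℕ, ∀ y z, g n y ≤ g n z + n * dist y z) ∧ (∀ y, Monotone fun n ↦ g n y) ∧
      ∀ y, Tendsto (fun n ↦ g n y) atTop (nhds (c y)) := by
  have hnn (n : ℕ) (y q : Y) : 0 ≤ min (c q) n + n * dist y q := by
    have := hc0 q
    positivity
  have hbdd (n : ℕ) (y : Y) : BddBelow (Set.range fun q ↦ min (c q) n + n * dist y q) :=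
    ⟨0, by rintro _ ⟨q, rfl⟩; exact hnn n y q⟩
  have hself (n : ℕ) (y : Y) : ⨅ q, (min (c q) n + n * dist y q) ≤ min (c y) n :=
    (ciInf_le (hbdd n y) y).trans (by simp)
  refine ⟨fun n y ↦ ⨅ q, (min (c q) n + n * dist y q), fun n y ↦ Real.iInf_nonneg (hnn n y),
    fun n y ↦ (hself n y).trans (min_le_left _ _), fun n y ↦ (hself n y).trans (min_le_right _ _),
    fun n y z ↦ ?_, fun y m n hmn ↦ ?_, fun y ↦ ?_⟩
  · have : Nonempty Y := ⟨y⟩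
    rw [← sub_le_iff_le_add]
    refine le_ciInf fun q ↦ ?_
    rw [sub_le_iff_le_add]
    refine (ciInf_le (hbdd n y) q).trans ?_
    have := mul_le_mul_of_nonneg_left (dist_triangle y z q) (Nat.cast_nonneg (α := ℝ) n)
    linarith
  · have : Nonempty Y := ⟨y⟩
    refine le_ciInf fun q ↦ (ciInf_le (hbdd m y) q).trans ?_
    have : (m : ℝ) ≤ n := by exact_mod_cast hmn
    gcongr
  · have : Nonempty Y := ⟨y⟩
    refine tendsto_order.2 ⟨fun r hr ↦ ?_, fun r hr ↦ Eventually.of_forall fun n ↦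
      ((hself n y).trans (min_le_left _ _)).trans_lt hr⟩
    obtain ⟨s, hrs, hs⟩ := exists_between hr
    obtain ⟨δ, hδ, hball⟩ := Metric.eventually_nhds_iff.1 (hc y s hs)
    filter_upwards [eventually_ge_atTop (⌈s⌉₊), eventually_ge_atTop (⌈s / δ⌉₊)] with n h1 h2
    refine hrs.trans_le (le_ciInf fun q ↦ ?_)
    have h1' : s ≤ n := Nat.ceil_le.1 h1
    have h2' : s ≤ n * δ := (div_le_iff₀ hδ).1 (Nat.ceil_le.1 h2)
    rcases lt_or_ge (dist q y) δ with h | h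
    · have : s ≤ min (c q) n := le_min (hball h).le h1'
      have : 0 ≤ n * dist y q := by positivity
      linarith
    · rw [dist_comm] at h
      have : (n : ℝ) * δ ≤ n * dist y q := by gcongr
      have : 0 ≤ min (c q) n := le_min (hc0 q) (by positivity)
      linarith

/-- Compactness of the set of couplings reduces a lower semicontinuous cost to bounded Lipschitz
costs. -/
lemma wassLike_le_of_forall_lipschitz {X : Type*} [MetricSpace X] [CompleteSpace X]
    [SecondCountableTopology X] [MeasurableSpace X] [BorelSpace X] {c : X → X → ℝ}
    (hc0 : ∀ u v, 0 ≤ c u v) (hc : LowerSemicontinuous fun p : X × X ↦ c p.1 p.2)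
    (μ ν : Measure X) [IsProbabilityMeasure μ] [IsProbabilityMeasure ν] {K : ℝ≥0∞}
    (h : ∀ (g : X → X → ℝ) (n : ℕ), (∀ u v, 0 ≤ g u v) → (∀ u v, g u v ≤ c u v) →
      (∀ u v, g u v ≤ n) →
      (∀ p q : X × X, g p.1 p.2 ≤ g q.1 q.2 + n * dist p q) → wassLike g μ ν ≤ K) :
    wassLike c μ ν ≤ K := by
  rcases eq_or_ne K ∞ with rfl | hK
  · exact le_top
  obtain ⟨g, g0, gc, gn, gL, gmono, glim⟩ :=
    hc.exists_lipschitz_approx (fun p : X × X ↦ hc0 p.1 p.2)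
  have gcont (n : ℕ) : Continuous (g n) :=
    (LipschitzWith.of_le_add_mul (n : NNReal) (by simpa using gL n)).continuous
  have ex (n : ℕ) : ∃ Γ : Measure (X × X), IsProbabilityMeasure Γ ∧ IsCoupling μ ν Γ ∧
      ∫⁻ p, ENNReal.ofReal (g n p) ∂Γ < K + (n + 1 : ℝ≥0∞)⁻¹ := by
    refine exists_coupling_of_wassLike_lt (c := fun u v ↦ g n (u, v))
      ((h _ n (fun u v ↦ g0 n _) (fun u v ↦ gc n _) (fun u v ↦ gn n _) fun p q ↦
        gL n p q).trans_lt (ENNReal.lt_add_right hK ?_))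
    simp
  choose Γ hΓ hΓc hΓlt using ex
  let S : Set (ProbabilityMeasure (X × X)) :=
    {Γ | IsCoupling μ ν (Γ : Measure (X × X))}
  have hS : IsCompact (closure S) := by
    refine isCompact_closure_of_isTightMeasureSet ?_
    rw [isTightMeasureSet_iff_exists_isCompact_measure_compl_le]
    intro ε hε
    have hε2 : 0 < ε / 2 := ENNReal.half_pos hε.ne'
    obtain ⟨K₁, hK₁, h₁⟩ := isTightMeasureSet_iff_exists_isCompact_measure_compl_le.1
      (isTightMeasureSet_singleton (μ := μ)) _ hε2
    obtain ⟨K₂, hK₂, h₂⟩ := isTightMeasureSet_iff_exists_isCompact_measure_compl_le.1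
      (isTightMeasureSet_singleton (μ := ν)) _ hε2
    refine ⟨K₁ ×ˢ K₂, hK₁.prod hK₂, ?_⟩
    rintro _ ⟨Γ, hΓ, rfl⟩
    have hsub : (K₁ ×ˢ K₂)ᶜ ⊆ (Prod.fst ⁻¹' K₁ᶜ : Set (X × X)) ∪ Prod.snd ⁻¹' K₂ᶜ := by
      rintro ⟨x, y⟩ hxy
      simp only [Set.mem_compl_iff, Set.mem_prod, not_and_or] at hxy
      exact hxy
    calc (Γ : Measure (X × X)) (K₁ ×ˢ K₂)ᶜ
        ≤ (Γ : Measure (X × X)) (Prod.fst ⁻¹' K₁ᶜ) + (Γ : Measure (X × X)) (Prod.snd ⁻¹' K₂ᶜ) :=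
          (measure_mono hsub).trans (measure_union_le _ _)
      _ = μ K₁ᶜ + ν K₂ᶜ := by
          conv_rhs => rw [← hΓ.1, ← hΓ.2]
          rw [Measure.map_apply measurable_fst hK₁.isClosed.measurableSet.compl,
            Measure.map_apply measurable_snd hK₂.isClosed.measurableSet.compl]
      _ ≤ ε / 2 + ε / 2 := add_le_add (h₁ _ rfl) (h₂ _ rfl)
      _ = ε := ENNReal.add_halves ε
  let Γp (n : ℕ) : ProbabilityMeasure (X × X) := ⟨Γ n, hΓ n⟩
  let F : Ultrafilter ℕ := Ultrafilter.of atTop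
  have hF : (F : Filter ℕ) ≤ atTop := Ultrafilter.of_le _
  obtain ⟨Γ', -, hΓ'⟩ := hS.ultrafilter_le_nhds (F.map Γp) (by
    rw [Filter.le_principal_iff]
    exact Filter.mem_map.2 (Filter.univ_mem' fun n ↦ subset_closure (hΓc n)))
  have hlim : Tendsto Γp F (nhds Γ') := hΓ'
  have hmarg {f : X × X → X} (hf : Continuous f) {π : Measure X} (hπ : ∀ n, (Γ n).map f = π) :
      (Γ' : Measure (X × X)).map f = π := by
    have h1 := ProbabilityMeasure.tendsto_map_of_tendsto_of_continuous Γp Γ' hlim hf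
    have hconst (n : ℕ) : (Γp n).map hf.measurable.aemeasurable
        = (Γp 0).map hf.measurable.aemeasurable :=
      Subtype.ext ((hπ n).trans (hπ 0).symm)
    simp_rw [hconst] at h1
    have h2 := congrArg (fun m : ProbabilityMeasure X ↦ (m : Measure X))
      (tendsto_nhds_unique h1 tendsto_const_nhds)
    exact h2.trans (hπ 0)
  refine (wassLike_le (Γ := (Γ' : Measure (X × X))) inferInstance
    ⟨hmarg continuous_fst fun n ↦ (hΓc n).1, hmarg continuous_snd fun n ↦ (hΓc n).2⟩).trans ?_
  have hm (m : ℕ) : ∫⁻ p, ENNReal.ofReal (g m p) ∂(Γ' : Measure (X × X)) ≤ K := by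
    let G : BoundedContinuousFunction (X × X) NNReal :=
      BoundedContinuousFunction.mkOfBound ⟨fun p ↦ (g m p).toNNReal,
        continuous_real_toNNReal.comp (gcont m)⟩ m fun p q ↦ by
          have hp : ((g m p).toNNReal : ℝ) = g m p := Real.coe_toNNReal _ (g0 m p)
          have hq : ((g m q).toNNReal : ℝ) = g m q := Real.coe_toNNReal _ (g0 m q)
          have := g0 m p; have := g0 m q; have := gn m p; have := gn m q
          simp only [ContinuousMap.coe_mk, NNReal.dist_eq, hp, hq, abs_le]
          constructor <;> linarith
    have h1 := ProbabilityMeasure.tendsto_iff_forall_lintegral_tendsto.1 hlim G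
    have h2 : Tendsto (fun n : ℕ ↦ K + (n + 1 : ℝ≥0∞)⁻¹) F (nhds (K + 0)) := by
      refine (tendsto_const_nhds.add ?_).mono_left hF
      have := (tendsto_add_atTop_iff_nat 1).2 ENNReal.tendsto_inv_nat_nhds_zero
      simpa using this
    rw [add_zero] at h2
    refine le_of_tendsto_of_tendsto h1 h2 ?_
    filter_upwards [hF (eventually_ge_atTop m)] with n hn
    exact (lintegral_mono fun p ↦ ENNReal.ofReal_le_ofReal (gmono p hn)).trans (hΓlt n).le
  have hlim' := lintegral_tendsto_of_tendsto_of_monotone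
    (μ := (Γ' : Measure (X × X))) (f := fun n p ↦ ENNReal.ofReal (g n p))
    (F := fun p ↦ ENNReal.ofReal (c p.1 p.2))
    (fun n ↦ (gcont n).measurable.ennreal_ofReal.aemeasurable)
    (Eventually.of_forall fun p m n hmn ↦ ENNReal.ofReal_le_ofReal (gmono p hmn))
    (Eventually.of_forall fun p ↦ ENNReal.tendsto_ofReal (glim p))
  exact le_of_tendsto' hlim' hm

/-- The set of triples `(p, q, r)` such that some coupling of the weights `p` and `q` on a finite
type has cost at most `r`. -/
def finiteTransportSet {ι : Type*} [Fintype ι] (d : ι → ι → ℝ) :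
    Set ((ι → ℝ) × (ι → ℝ) × ℝ) :=
  {x | ∃ π ∈ stdSimplex ℝ (ι × ι), (∀ j, ∑ k, π (j, k) = x.1 j) ∧
    (∀ k, ∑ j, π (j, k) = x.2.1 k) ∧ ∑ jk, π jk * d jk.1 jk.2 ≤ x.2.2}

lemma convex_finiteTransportSet {ι : Type*} [Fintype ι] (d : ι → ι → ℝ) :
    Convex ℝ (finiteTransportSet d) := by
  rintro x ⟨π, hπ, h1, h2, h3⟩ y ⟨σ, hσ, k1, k2, k3⟩ a b ha hb hab
  refine ⟨a • π + b • σ, convex_stdSimplex ℝ _ hπ hσ ha hb hab, fun j ↦ ?_, fun k ↦ ?_, ?_⟩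
  · simp [Finset.sum_add_distrib, ← Finset.mul_sum, h1, k1]
  · simp [Finset.sum_add_distrib, ← Finset.mul_sum, h2, k2]
  · have : ∑ jk, (a • π + b • σ) jk * d jk.1 jk.2
        = a * ∑ jk, π jk * d jk.1 jk.2 + b * ∑ jk, σ jk * d jk.1 jk.2 := by
      simp [Finset.mul_sum, add_mul, Finset.sum_add_distrib, mul_assoc]
    rw [this]
    exact add_le_add (mul_le_mul_of_nonneg_left h3 ha) (mul_le_mul_of_nonneg_left k3 hb)

lemma isClosed_finiteTransportSet {ι : Type*} [Fintype ι] (d : ι → ι → ℝ) :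
    IsClosed (finiteTransportSet d) := by
  have hcomp : CompactSpace (stdSimplex ℝ (ι × ι)) :=
    isCompact_iff_compactSpace.1 (isCompact_stdSimplex ℝ (ι × ι))
  have hcl : IsClosed {z : stdSimplex ℝ (ι × ι) × ((ι → ℝ) × (ι → ℝ) × ℝ) |
      (∀ j, ∑ k, z.1.1 (j, k) = z.2.1 j) ∧ (∀ k, ∑ j, z.1.1 (j, k) = z.2.2.1 k) ∧
        ∑ jk, z.1.1 jk * d jk.1 jk.2 ≤ z.2.2.2} := by
    have hev (jk : ι × ι) : Continuous
        fun z : stdSimplex ℝ (ι × ι) × ((ι → ℝ) × (ι → ℝ) × ℝ) ↦ z.1.1 jk :=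
      (continuous_apply jk).comp (continuous_subtype_val.comp continuous_fst)
    simp only [Set.ofPred_and, Set.ofPred_forall]
    refine (isClosed_iInter fun j ↦ isClosed_eq ?_ ?_).inter
      ((isClosed_iInter fun k ↦ isClosed_eq ?_ ?_).inter (isClosed_le ?_ ?_))
    · exact continuous_finsetSum _ fun k _ ↦ hev _
    · fun_prop
    · exact continuous_finsetSum _ fun k _ ↦ hev _
    · fun_prop
    · exact continuous_finsetSum _ fun k _ ↦ (hev _).mul continuous_const
    · fun_prop
  convert isClosedMap_snd_of_compactSpace _ hcl using 1
  ext x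
  constructor
  · rintro ⟨π, hπ, h⟩
    exact ⟨(⟨π, hπ⟩, x), h, rfl⟩
  · rintro ⟨⟨π, y⟩, h, rfl⟩
    exact ⟨π.1, π.2, h⟩

/-- A coupling of the discretized marginals lifts to a coupling of the measures. -/
lemma wassLike_le_of_mem_finiteTransportSet {X ι : Type*} [MeasurableSpace X] [Fintype ι]
    [MeasurableSpace ι] [MeasurableSingletonClass ι] {i : X → ι} (hi : Measurable i)
    {d : ι → ι → ℝ} (hd : ∀ j k, 0 ≤ d j k) {μ ν : Measure X} [IsProbabilityMeasure μ]
    [IsProbabilityMeasure ν] {r : ℝ}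
    (h : (fun j ↦ μ.real (i ⁻¹' {j}), fun k ↦ ν.real (i ⁻¹' {k}), r) ∈ finiteTransportSet d) :
    wassLike (fun u v ↦ d (i u) (i v)) μ ν ≤ ENNReal.ofReal r := by
  obtain ⟨π, hπ, h1, h2, h3⟩ := h
  simp only at h1 h2 h3
  have hE (j : ι) : MeasurableSet (i ⁻¹' {j}) := hi (measurableSet_singleton j)
  have hsum1 (j : ι) : ∑ k, ENNReal.ofReal (π (j, k)) = μ (i ⁻¹' {j}) := by
    rw [← ENNReal.ofReal_sum_of_nonneg fun k _ ↦ hπ.1 _, h1, ofReal_measureReal]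
  have hsum2 (k : ι) : ∑ j, ENNReal.ofReal (π (j, k)) = ν (i ⁻¹' {k}) := by
    rw [← ENNReal.ofReal_sum_of_nonneg fun k _ ↦ hπ.1 _, h2, ofReal_measureReal]
  have hz1 (j k : ι) (h0 : μ (i ⁻¹' {j}) = 0) : ENNReal.ofReal (π (j, k)) = 0 :=
    Finset.sum_eq_zero_iff.1 ((hsum1 j).trans h0) k (Finset.mem_univ _)
  have hz2 (j k : ι) (h0 : ν (i ⁻¹' {k}) = 0) : ENNReal.ofReal (π (j, k)) = 0 :=
    Finset.sum_eq_zero_iff.1 ((hsum2 k).trans h0) j (Finset.mem_univ _)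
  have hc1 (j k : ι) : ENNReal.ofReal (π (j, k)) * ((μ (i ⁻¹' {j}))⁻¹ * μ (i ⁻¹' {j}))
      = ENNReal.ofReal (π (j, k)) := by
    by_cases h0 : μ (i ⁻¹' {j}) = 0
    · simp [hz1 j k h0]
    · rw [ENNReal.inv_mul_cancel h0 (measure_ne_top _ _), mul_one]
  have hc2 (j k : ι) : ENNReal.ofReal (π (j, k)) * ((ν (i ⁻¹' {k}))⁻¹ * ν (i ⁻¹' {k}))
      = ENNReal.ofReal (π (j, k)) := by
    by_cases h0 : ν (i ⁻¹' {k}) = 0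
    · simp [hz2 j k h0]
    · rw [ENNReal.inv_mul_cancel h0 (measure_ne_top _ _), mul_one]
  set a : ι × ι → ℝ≥0∞ := fun x ↦
    ENNReal.ofReal (π x) * ((μ (i ⁻¹' {x.1}))⁻¹ * (ν (i ⁻¹' {x.2}))⁻¹) with ha
  set Γ : Measure (X × X) := ∑ x : ι × ι,
    a x • (μ.restrict (i ⁻¹' {x.1})).prod (ν.restrict (i ⁻¹' {x.2})) with hΓ
  have split (m : Measure X) {A : Set X} (hA : MeasurableSet A) :
      ∑ j, m (A ∩ i ⁻¹' {j}) = m A := by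
    rw [← measure_biUnion_finset (fun j _ k _ hjk ↦ ?_) fun j _ ↦ hA.inter (hE j)]
    · congr 1; ext x; simp
    · exact Disjoint.mono Set.inter_subset_right Set.inter_subset_right
        ((Set.disjoint_singleton.2 hjk).preimage i)
  have hcoup : IsCoupling μ ν Γ := by
    constructor
    · ext A hA
      rw [Measure.map_apply measurable_fst hA, ← Set.prod_univ]
      simp only [hΓ, Measure.finsetSum_apply, Measure.smul_apply, Measure.prod_prod, smul_eq_mul,
        Measure.restrict_apply hA, Measure.restrict_apply_univ, Fintype.sum_prod_type, ha]
      rw [← split μ hA]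
      refine Finset.sum_congr rfl fun j _ ↦ ?_
      calc _ = ∑ k, ENNReal.ofReal (π (j, k)) * ((ν (i ⁻¹' {k}))⁻¹ * ν (i ⁻¹' {k}))
              * ((μ (i ⁻¹' {j}))⁻¹ * μ (A ∩ i ⁻¹' {j})) :=
            Finset.sum_congr rfl fun k _ ↦ by ring
        _ = μ (i ⁻¹' {j}) * ((μ (i ⁻¹' {j}))⁻¹ * μ (A ∩ i ⁻¹' {j})) := by
            simp_rw [hc2, ← Finset.sum_mul, hsum1]
        _ = μ (A ∩ i ⁻¹' {j}) := by
            by_cases h0 : μ (i ⁻¹' {j}) = 0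
            · simp [h0, measure_mono_null Set.inter_subset_right h0]
            · rw [← mul_assoc, ENNReal.mul_inv_cancel h0 (measure_ne_top _ _), one_mul]
    · ext A hA
      rw [Measure.map_apply measurable_snd hA, ← Set.univ_prod]
      simp only [hΓ, Measure.finsetSum_apply, Measure.smul_apply, Measure.prod_prod, smul_eq_mul,
        Measure.restrict_apply hA, Measure.restrict_apply_univ, Fintype.sum_prod_type_right, ha]
      rw [← split ν hA]
      refine Finset.sum_congr rfl fun k _ ↦ ?_
      calc _ = ∑ j, ENNReal.ofReal (π (j, k)) * ((μ (i ⁻¹' {j}))⁻¹ * μ (i ⁻¹' {j}))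
              * ((ν (i ⁻¹' {k}))⁻¹ * ν (A ∩ i ⁻¹' {k})) :=
            Finset.sum_congr rfl fun j _ ↦ by ring
        _ = ν (i ⁻¹' {k}) * ((ν (i ⁻¹' {k}))⁻¹ * ν (A ∩ i ⁻¹' {k})) := by
            simp_rw [hc1, ← Finset.sum_mul, hsum2]
        _ = ν (A ∩ i ⁻¹' {k}) := by
            by_cases h0 : ν (i ⁻¹' {k}) = 0
            · simp [h0, measure_mono_null Set.inter_subset_right h0]
            · rw [← mul_assoc, ENNReal.mul_inv_cancel h0 (measure_ne_top _ _), one_mul]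
  have hprob : IsProbabilityMeasure Γ := by
    refine ⟨?_⟩
    have := Measure.map_apply (μ := Γ) measurable_fst MeasurableSet.univ
    rw [hcoup.1, measure_univ, Set.preimage_univ] at this
    exact this.symm
  refine (wassLike_le hprob hcoup).trans ?_
  rw [hΓ, lintegral_finsetSum_measure]
  simp only [lintegral_smul_measure, smul_eq_mul, Measure.prod_restrict]
  have hint (x : ι × ι) : ∫⁻ p in (i ⁻¹' {x.1}) ×ˢ (i ⁻¹' {x.2}),
      ENNReal.ofReal (d (i p.1) (i p.2)) ∂(μ.prod ν)
        = ENNReal.ofReal (d x.1 x.2) * (μ (i ⁻¹' {x.1}) * ν (i ⁻¹' {x.2})) := by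
    rw [setLIntegral_congr_fun (g := fun _ ↦ ENNReal.ofReal (d x.1 x.2))
      ((hE _).prod (hE _)) ?_, setLIntegral_const, Measure.prod_prod]
    rintro p ⟨hp1, hp2⟩
    simp only [Set.mem_preimage, Set.mem_singleton_iff] at hp1 hp2
    simp [hp1, hp2]
  calc ∑ x, a x * ∫⁻ p in (i ⁻¹' {x.1}) ×ˢ (i ⁻¹' {x.2}),
        ENNReal.ofReal (d (i p.1) (i p.2)) ∂(μ.prod ν)
      = ∑ x : ι × ι, ENNReal.ofReal (π x * d x.1 x.2) := by
        refine Finset.sum_congr rfl fun x _ ↦ ?_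
        rw [hint, ENNReal.ofReal_mul (hπ.1 x)]
        calc _ = ENNReal.ofReal (π x) * ((μ (i ⁻¹' {x.1}))⁻¹ * μ (i ⁻¹' {x.1}))
              * ((ν (i ⁻¹' {x.2}))⁻¹ * ν (i ⁻¹' {x.2})) * ENNReal.ofReal (d x.1 x.2) := by
              simp only [ha]
              ring
          _ = _ := by rw [hc1 x.1 x.2, hc2 x.1 x.2]
    _ = ENNReal.ofReal (∑ x : ι × ι, π x * d x.1 x.2) :=
        (ENNReal.ofReal_sum_of_nonneg fun x _ ↦ mul_nonneg (hπ.1 x) (hd _ _)).symm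
    _ ≤ ENNReal.ofReal r := ENNReal.ofReal_le_ofReal h3

lemma mem_finiteTransportSet_of_wassLike_lt {X ι : Type*} [MeasurableSpace X] [Fintype ι]
    [MeasurableSpace ι] [MeasurableSingletonClass ι] {i : X → ι} (hi : Measurable i)
    {d : ι → ι → ℝ} (hd : ∀ j k, 0 ≤ d j k) {μ ν : Measure X} {r : ℝ}
    (h : wassLike (fun u v ↦ d (i u) (i v)) μ ν < ENNReal.ofReal r) :
    (fun j ↦ μ.real (i ⁻¹' {j}), fun k ↦ ν.real (i ⁻¹' {k}), r) ∈ finiteTransportSet d := by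
  obtain ⟨Γ, hΓ, hc, hlt⟩ := exists_coupling_of_wassLike_lt h
  have hr : 0 ≤ r := by
    by_contra hr
    simp [ENNReal.ofReal_of_nonpos (not_le.1 hr).le] at hlt
  have hi2 : Measurable (Prod.map i i) := hi.prodMap hi
  have hE (x : ι × ι) : MeasurableSet (Prod.map i i ⁻¹' {x}) := hi2 (measurableSet_singleton x)
  refine ⟨fun x ↦ Γ.real (Prod.map i i ⁻¹' {x}), ⟨fun x ↦ measureReal_nonneg, ?_⟩, fun j ↦ ?_,
    fun k ↦ ?_, ?_⟩
  · rw [sum_measureReal_preimage_singleton _ fun x _ ↦ hE x]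
    simp
  · simp only
    rw [← hc.1, map_measureReal_apply measurable_fst (hi (measurableSet_singleton j)),
      ← measureReal_biUnion_finset (fun k _ l _ hkl ↦ ?_) fun k _ ↦ hE _]
    · congr 1; ext p; simp [Prod.ext_iff]
    · exact (Set.disjoint_singleton.2 fun h ↦ hkl (congrArg Prod.snd h)).preimage _
  · simp only
    rw [← hc.2, map_measureReal_apply measurable_snd (hi (measurableSet_singleton k)),
      ← measureReal_biUnion_finset (fun k _ l _ hkl ↦ ?_) fun k _ ↦ hE _]
    · congr 1; ext p; simp [Prod.ext_iff]
    · exact (Set.disjoint_singleton.2 fun h ↦ hkl (congrArg Prod.fst h)).preimage _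
  · rw [← ENNReal.ofReal_le_ofReal_iff hr, ENNReal.ofReal_sum_of_nonneg fun x _ ↦
      mul_nonneg measureReal_nonneg (hd _ _)]
    refine le_trans (le_of_eq ?_) hlt.le
    have : (fun p : X × X ↦ ENNReal.ofReal (d (i p.1) (i p.2)))
        = fun p ↦ (fun x : ι × ι ↦ ENNReal.ofReal (d x.1 x.2)) (Prod.map i i p) := rfl
    rw [this, ← lintegral_map (f := fun x : ι × ι ↦ ENNReal.ofReal (d x.1 x.2))
      (measurable_of_countable _) hi2, lintegral_fintype]
    refine Finset.sum_congr rfl fun x _ ↦ ?_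
    rw [mul_comm, ENNReal.ofReal_mul (hd _ _), ofReal_measureReal,
      Measure.map_apply hi2 (measurableSet_singleton x)]

/-- Convexity of the transport cost along a mixture, for a cost that only depends on the cell of a
finite partition. -/
lemma wassLike_bind_le_of_finite {X Ω ι : Type*} [MeasurableSpace X] [MeasurableSpace Ω]
    [Fintype ι] [MeasurableSpace ι] [MeasurableSingletonClass ι] {i : X → ι} (hi : Measurable i)
    {d : ι → ι → ℝ} (hd : ∀ j k, 0 ≤ d j k) (m : Measure Ω) [IsProbabilityMeasure m]
    {κ η : Ω → Measure X} (hκ : Measurable κ) (hη : Measurable η)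
    [∀ ω, IsProbabilityMeasure (κ ω)] [∀ ω, IsProbabilityMeasure (η ω)]
    {F : Ω → ℝ≥0∞} (hF : Measurable F)
    (h : ∀ ω, wassLike (fun u v ↦ d (i u) (i v)) (κ ω) (η ω) ≤ F ω) :
    wassLike (fun u v ↦ d (i u) (i v)) (m.bind κ) (m.bind η) ≤ ∫⁻ ω, F ω ∂m := by
  have hprob {κ : Ω → Measure X} [∀ ω, IsProbabilityMeasure (κ ω)] (hκ : Measurable κ) :
      IsProbabilityMeasure (m.bind κ) :=
    isProbabilityMeasure_bind hκ.aemeasurable (Eventually.of_forall inferInstance)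
  have := hprob hκ
  have := hprob hη
  refine ENNReal.le_of_forall_pos_le_add fun ε hε hfin ↦ ?_
  have hint {κ : Ω → Measure X} [∀ ω, IsProbabilityMeasure (κ ω)] (hκ : Measurable κ) (j : ι) :
      Integrable (fun ω ↦ (κ ω).real (i ⁻¹' {j})) m := by
    refine Integrable.of_bound (C := 1) ?_ (Eventually.of_forall fun ω ↦ ?_)
    · exact ((Measure.measurable_coe (hi (measurableSet_singleton j))).comp
        hκ).ennreal_toReal.aestronglyMeasurable
    · simp [abs_of_nonneg]
  have hval {κ : Ω → Measure X} [∀ ω, IsProbabilityMeasure (κ ω)] (hκ : Measurable κ) (j : ι) :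
      ∫ ω, (κ ω).real (i ⁻¹' {j}) ∂m = (m.bind κ).real (i ⁻¹' {j}) := by
    have hj := hi (measurableSet_singleton j)
    simp only [Measure.real]
    rw [integral_toReal, Measure.bind_apply hj hκ.aemeasurable]
    · exact ((Measure.measurable_coe hj).comp hκ).aemeasurable
    · exact Eventually.of_forall fun ω ↦ measure_lt_top _ _
  have hFint : Integrable (fun ω ↦ (F ω).toReal) m :=
    integrable_toReal_of_lintegral_ne_top hF.aemeasurable hfin.ne
  have hFint' : Integrable (fun ω ↦ (F ω).toReal + ε) m := hFint.add (integrable_const _)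
  have i1 := Integrable.of_eval (hint hκ)
  have i2 := Integrable.of_eval (hint hη)
  have hmem := (convex_finiteTransportSet d).integral_mem (isClosed_finiteTransportSet d) (μ := m)
    (f := fun ω ↦ (fun j ↦ (κ ω).real (i ⁻¹' {j}), fun k ↦ (η ω).real (i ⁻¹' {k}),
      (F ω).toReal + ε)) (by
        filter_upwards [ae_lt_top hF hfin.ne] with ω hω
        refine mem_finiteTransportSet_of_wassLike_lt hi hd ((h ω).trans_lt ?_)
        rw [ENNReal.ofReal_add ENNReal.toReal_nonneg ε.coe_nonneg, ENNReal.ofReal_toReal hω.ne]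
        exact ENNReal.lt_add_right hω.ne (by simpa using hε.ne'))
    (i1.prodMk (i2.prodMk hFint'))
  have heq : ∫ ω, ((fun j ↦ (κ ω).real (i ⁻¹' {j}), fun k ↦ (η ω).real (i ⁻¹' {k}),
      (F ω).toReal + ε) : (ι → ℝ) × (ι → ℝ) × ℝ) ∂m
      = (fun j ↦ (m.bind κ).real (i ⁻¹' {j}), fun k ↦ (m.bind η).real (i ⁻¹' {k}),
        (∫⁻ ω, F ω ∂m).toReal + ε) := by
    rw [integral_pair i1 (i2.prodMk hFint'), integral_pair i2 hFint',
      integral_add hFint (integrable_const _),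
      integral_toReal hF.aemeasurable (ae_lt_top hF hfin.ne)]
    refine Prod.ext (funext fun j ↦ ?_) (Prod.ext (funext fun j ↦ ?_) (by simp))
    · exact (eval_integral (hint hκ) j).trans (hval hκ j)
    · exact (eval_integral (hint hη) j).trans (hval hη j)
  rw [heq] at hmem
  refine (wassLike_le_of_mem_finiteTransportSet hi hd hmem).trans (le_of_eq ?_)
  rw [ENNReal.ofReal_add ENNReal.toReal_nonneg ε.coe_nonneg, ENNReal.ofReal_toReal hfin.ne,
    ENNReal.ofReal_coe_nnreal]

/-- Up to a set of small measure, a separable metric space splits into finitely many measurable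
cells of small diameter. -/
lemma exists_measurable_finite_cells {X : Type*} [PseudoMetricSpace X] [SecondCountableTopology X]
    [MeasurableSpace X] [BorelSpace X] [Nonempty X] (μ ν : Measure X) [IsFiniteMeasure μ]
    [IsFiniteMeasure ν] {δ : ℝ} (hδ : 0 < δ) {ε : ℝ≥0∞} (hε : 0 < ε) :
    ∃ (M : ℕ) (i : X → Option (Fin M)) (x : Fin M → X),
      (∀ j, MeasurableSet (i ⁻¹' {j})) ∧ (∀ y j, i y = some j → dist y (x j) < δ) ∧
      μ (i ⁻¹' {none}) ≤ ε ∧ ν (i ⁻¹' {none}) ≤ ε := by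
  classical
  let z := TopologicalSpace.denseSeq X
  have hex (y : X) : ∃ n, dist y (z n) < δ :=
    (TopologicalSpace.denseRange_denseSeq X).exists_dist_lt y hδ
  let f (y : X) : ℕ := Nat.find (hex y)
  have hf : Measurable f := measurable_find hex fun k ↦ Metric.isOpen_ball.measurableSet
  have hanti : Antitone fun M ↦ f ⁻¹' Set.Ici M := fun a b hab y hy ↦ hab.trans hy
  have hempty : ⋂ M, f ⁻¹' Set.Ici M = ∅ := by
    refine Set.eq_empty_of_forall_notMem fun y hy ↦ ?_
    have := Set.mem_iInter.1 hy (f y + 1)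
    simp at this
  have htail (μ : Measure X) [IsFiniteMeasure μ] : ∀ᶠ M in atTop, μ (f ⁻¹' Set.Ici M) ≤ ε := by
    have := tendsto_measure_iInter_atTop (μ := μ)
      (fun M ↦ (hf (measurableSet_Ici (a := M))).nullMeasurableSet) hanti ⟨0, measure_ne_top _ _⟩
    rw [hempty, measure_empty] at this
    exact this.eventually (ge_mem_nhds hε)
  obtain ⟨M, hM, hM'⟩ := ((htail μ).and (htail ν)).exists
  have hnone : (fun y ↦ if h : f y < M then some ⟨f y, h⟩ else none : X → Option (Fin M)) ⁻¹' {none}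
      = f ⁻¹' Set.Ici M := by
    ext y
    simp
  refine ⟨M, fun y ↦ if h : f y < M then some ⟨f y, h⟩ else none, fun j ↦ z j, ?_, ?_, ?_, ?_⟩
  · rintro (_ | j)
    · rw [hnone]; exact hf measurableSet_Ici
    · convert hf (measurableSet_singleton (j : ℕ)) using 1
      ext y
      simp only [Set.mem_preimage, Set.mem_singleton_iff, Option.dite_none_right_eq_some,
        Option.some.injEq, Fin.ext_iff]
      exact ⟨fun ⟨_, h⟩ ↦ h, fun h ↦ ⟨h ▸ j.2, h⟩⟩
  · intro y j h
    simp only [Option.dite_none_right_eq_some, Option.some.injEq, Fin.ext_iff] at h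
    obtain ⟨_, h⟩ := h
    have := Nat.find_spec (hex y)
    change dist y (z (j : ℕ)) < δ
    rw [← h]
    exact this
  · rwa [hnone]
  · rwa [hnone]

lemma wassLike_bind_le_of_lipschitz {X Ω : Type*} [PseudoMetricSpace X]
    [SecondCountableTopology X] [MeasurableSpace X] [BorelSpace X] [MeasurableSpace Ω]
    {c : X → X → ℝ} {n : ℕ} (hc0 : ∀ u v, 0 ≤ c u v) (hcn : ∀ u v, c u v ≤ n)
    (hcL : ∀ p q : X × X, c p.1 p.2 ≤ c q.1 q.2 + n * dist p q)
    (m : Measure Ω) [IsProbabilityMeasure m] {κ η : Ω → Measure X} (hκ : Measurable κ)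
    (hη : Measurable η) [∀ ω, IsProbabilityMeasure (κ ω)] [∀ ω, IsProbabilityMeasure (η ω)]
    {F : Ω → ℝ≥0∞} (hF : Measurable F) (h : ∀ ω, wassLike c (κ ω) (η ω) ≤ F ω) :
    wassLike c (m.bind κ) (m.bind η) ≤ ∫⁻ ω, F ω ∂m := by
  have hprob {κ : Ω → Measure X} [∀ ω, IsProbabilityMeasure (κ ω)] (hκ : Measurable κ) :
      IsProbabilityMeasure (m.bind κ) :=
    isProbabilityMeasure_bind hκ.aemeasurable (Eventually.of_forall inferInstance)
  have h1 := hprob hκ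
  have h2 := hprob hη
  have : Nonempty X := nonempty_of_isProbabilityMeasure (m.bind κ)
  refine ENNReal.le_of_forall_pos_le_add fun ε hε _ ↦ ?_
  have hε' : (0 : ℝ) < ε := hε
  set τ : ℝ := ε / (2 * n + 2) with hτ
  have hτ0 : 0 < τ := by positivity
  have hnτ : 2 * n * τ + 2 * τ = ε := by rw [hτ]; field_simp
  obtain ⟨M, i, x, hi, hix, hμi, hνi⟩ := exists_measurable_finite_cells (m.bind κ) (m.bind η)
    (δ := τ / (n + 1)) (by positivity) (ε := ENNReal.ofReal τ) (by simpa using hτ0)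
  let _ : MeasurableSpace (Option (Fin M)) := ⊤
  have hi' : Measurable i := measurable_to_countable' hi
  let d : Option (Fin M) → Option (Fin M) → ℝ
    | some j, some k => c (x j) (x k)
    | _, _ => 0
  have hd (j k) : 0 ≤ d j k := by
    rcases j with _ | j <;> rcases k with _ | k <;> simp [d, hc0]
  have hclose {u v : X} {j k : Fin M} (hu : i u = some j) (hv : i v = some k) :
      n * dist (u, v) (x j, x k) ≤ τ := by
    have : dist (u, v) (x j, x k) ≤ τ / (n + 1) :=
      max_le (hix _ _ hu).le (hix _ _ hv).le
    calc n * dist (u, v) (x j, x k) ≤ (n + 1) * (τ / (n + 1)) := by gcongr; linarith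
      _ = τ := by field_simp
  have hdc (u v : X) : d (i u) (i v) ≤ c u v + τ := by
    have hc := hc0 u v
    rcases hu : i u with _ | j <;> rcases hv : i v with _ | k <;> simp only [d]
    · linarith
    · linarith
    · linarith
    · have := hcL (x j, x k) (u, v)
      rw [dist_comm] at this
      have := hclose hu hv
      simp only at *
      linarith
  let G : X → ℝ≥0∞ := (i ⁻¹' {none}).indicator fun _ ↦ (n : ℝ≥0∞)
  have hG : Measurable G := measurable_const.indicator (hi none)
  have hτN : ENNReal.ofReal τ ≠ ∞ := ENNReal.ofReal_ne_top
  have hcd (u v : X) : ENNReal.ofReal (c u v) ≤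
      ENNReal.ofReal (d (i u) (i v)) + ((G u + ENNReal.ofReal τ) + G v) := by
    have hn : ENNReal.ofReal (c u v) ≤ n := by
      rw [← ENNReal.ofReal_natCast]
      exact ENNReal.ofReal_le_ofReal (hcn u v)
    rcases hu : i u with _ | j
    · have : G u = n := by simp [G, hu]
      rw [this]
      exact hn.trans (by rw [add_assoc]; exact le_add_left le_self_add)
    rcases hv : i v with _ | k
    · have : G v = n := by simp [G, hv]
      rw [this]
      exact hn.trans (le_add_left le_add_self)
    · have h1 := hcL (u, v) (x j, x k)
      have h2 := hclose hu hv
      calc ENNReal.ofReal (c u v) ≤ ENNReal.ofReal (c (x j) (x k) + τ) :=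
            ENNReal.ofReal_le_ofReal (by simp only at *; linarith)
        _ = ENNReal.ofReal (d (some j) (some k)) + ENNReal.ofReal τ :=
            ENNReal.ofReal_add (hc0 _ _) hτ0.le
        _ ≤ _ := by gcongr; rw [add_right_comm]; exact le_add_self
  have hstep (ω : Ω) : wassLike (fun u v ↦ d (i u) (i v)) (κ ω) (η ω)
      ≤ F ω + ENNReal.ofReal τ := by
    refine (wassLike_le_add (c := fun u v ↦ d (i u) (i v)) (d := c)
      (G := fun _ ↦ ENNReal.ofReal τ) (H := fun _ ↦ 0) measurable_const measurable_const
      fun u v ↦ ?_).trans ?_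
    · rw [add_zero, ← ENNReal.ofReal_add (hc0 _ _) hτ0.le]
      exact ENNReal.ofReal_le_ofReal (hdc u v)
    · simpa using h ω
  have hmain := wassLike_bind_le_of_finite hi' hd m hκ hη (hF.add_const _) hstep
  rw [lintegral_add_right _ measurable_const, lintegral_const, measure_univ, mul_one] at hmain
  have hGint (ξ : Measure X) (hξ : ξ (i ⁻¹' {none}) ≤ ENNReal.ofReal τ) :
      ∫⁻ u, G u ∂ξ ≤ n * ENNReal.ofReal τ := by
    simp only [G]
    rw [lintegral_indicator_const (hi none)]
    gcongr
  calc wassLike c (m.bind κ) (m.bind η)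
      ≤ wassLike (fun u v ↦ d (i u) (i v)) (m.bind κ) (m.bind η)
        + (∫⁻ u, (G u + ENNReal.ofReal τ) ∂(m.bind κ) + ∫⁻ v, G v ∂(m.bind η)) :=
        wassLike_le_add (hG.add_const _) hG hcd
    _ ≤ (∫⁻ ω, F ω ∂m + ENNReal.ofReal τ)
        + ((n * ENNReal.ofReal τ + ENNReal.ofReal τ) + n * ENNReal.ofReal τ) := by
        rw [lintegral_add_right _ measurable_const, lintegral_const, measure_univ, mul_one]
        gcongr
        · exact hGint _ hμi
        · exact hGint _ hνi
    _ = ∫⁻ ω, F ω ∂m + (2 * n * ENNReal.ofReal τ + 2 * ENNReal.ofReal τ) := by ring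
    _ = ∫⁻ ω, F ω ∂m + ε := by
        rw [← ENNReal.ofReal_coe_nnreal (p := ε), ← hnτ, ENNReal.ofReal_add (by positivity)
          (by positivity), ENNReal.ofReal_mul (by positivity), ENNReal.ofReal_mul (by positivity),
          ENNReal.ofReal_mul (by positivity)]
        simp

/-- Convexity of the transport cost along a mixture. -/
lemma wassLike_bind_le {X Ω : Type*} [MetricSpace X] [CompleteSpace X]
    [SecondCountableTopology X] [MeasurableSpace X] [BorelSpace X] [MeasurableSpace Ω]
    {c : X → X → ℝ} (hc0 : ∀ u v, 0 ≤ c u v)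
    (hc : LowerSemicontinuous fun p : X × X ↦ c p.1 p.2)
    (m : Measure Ω) [IsProbabilityMeasure m] {κ η : Ω → Measure X} (hκ : Measurable κ)
    (hη : Measurable η) [∀ ω, IsProbabilityMeasure (κ ω)] [∀ ω, IsProbabilityMeasure (η ω)]
    {F : Ω → ℝ≥0∞} (hF : Measurable F) (h : ∀ ω, wassLike c (κ ω) (η ω) ≤ F ω) :
    wassLike c (m.bind κ) (m.bind η) ≤ ∫⁻ ω, F ω ∂m := by
  have hprob {κ : Ω → Measure X} [∀ ω, IsProbabilityMeasure (κ ω)] (hκ : Measurable κ) :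
      IsProbabilityMeasure (m.bind κ) :=
    isProbabilityMeasure_bind hκ.aemeasurable (Eventually.of_forall inferInstance)
  have h1 := hprob hκ
  have h2 := hprob hη
  exact wassLike_le_of_forall_lipschitz hc0 hc _ _ fun g n g0 gc gn gL ↦
    wassLike_bind_le_of_lipschitz g0 gn gL m hκ hη hF fun ω ↦ (wassLike_mono gc).trans (h ω)

end Transport

section Invariant

lemma iterate_bind_dirac {X : Type*} [MeasurableSpace X] {P : X → Measure X} (hP : Measurable P)
    (k : ℕ) (ξ : Measure X) :
    ξ.bind (fun u ↦ (fun m : Measure X ↦ m.bind P)^[k] (Measure.dirac u))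
      = (fun m : Measure X ↦ m.bind P)^[k] ξ := by
  induction k with
  | zero => simp
  | succ k ih =>
    have hk : Measurable fun u ↦ (fun m : Measure X ↦ m.bind P)^[k] (Measure.dirac u) :=
      ((Measure.measurable_bind' hP).iterate k).comp Measure.measurable_dirac
    simp only [Function.iterate_succ_apply']
    rw [← ih, Measure.bind_bind hk.aemeasurable hP.aemeasurable]

lemma isProbabilityMeasure_iterate_bind {X : Type*} [MeasurableSpace X] {P : X → Measure X}
    (hP : Measurable P) [∀ u, IsProbabilityMeasure (P u)] (k : ℕ) (ξ : Measure X)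
    [IsProbabilityMeasure ξ] :
    IsProbabilityMeasure ((fun m : Measure X ↦ m.bind P)^[k] ξ) := by
  induction k with
  | zero => assumption
  | succ k ih =>
    rw [Function.iterate_succ_apply']
    exact isProbabilityMeasure_bind hP.aemeasurable (Eventually.of_forall inferInstance)

lemma wassLike_le_of_le_const {X : Type*} [MeasurableSpace X] {c : X → X → ℝ} {M : ℝ}
    (hcM : ∀ u v, c u v ≤ M) (μ ν : Measure X) [IsProbabilityMeasure μ] [IsProbabilityMeasure ν] :
    wassLike c μ ν ≤ ENNReal.ofReal M := by
  refine (wassLike_mono (d := fun _ _ ↦ M) hcM).trans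
    ((wassLike_le (Γ := μ.prod ν) inferInstance ⟨?_, ?_⟩).trans ?_)
  · simp [Measure.map_fst_prod]
  · simp [Measure.map_snd_prod]
  · simp

lemma bind_map_eq_bind_comp {Ω Y Z : Type*} [MeasurableSpace Ω] [MeasurableSpace Y]
    [MeasurableSpace Z] (m : Measure Ω) {f : Ω → Y} (hf : Measurable f) {κ : Y → Measure Z}
    (hκ : Measurable κ) : (m.map f).bind κ = m.bind fun ω ↦ κ (f ω) := by
  rw [Measure.bind, Measure.map_map hκ hf]
  rfl

lemma wassLike_le_mul_add {X : Type*} [MeasurableSpace X] [StandardBorelSpace X]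
    {a b : X → X → ℝ} (ha : Measurable fun p : X × X ↦ a p.1 p.2)
    (hb : Measurable fun p : X × X ↦ b p.1 p.2) (hb0 : ∀ u v, 0 ≤ b u v)
    {A : ℝ} (hA : 0 < A) (h : ∀ u v w, a u v ≤ A * (b u w + b w v)) (μ κ ν : Measure X)
    [IsProbabilityMeasure μ] [IsProbabilityMeasure κ] [IsProbabilityMeasure ν] :
    wassLike a μ ν ≤ ENNReal.ofReal A * (wassLike b μ κ + wassLike b κ ν) := by
  have hAb : Measurable fun p : X × X ↦ A * b p.1 p.2 := hb.const_mul A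
  rw [mul_add]
  have htri := wassLike_triangle (c := a) (a := fun u v ↦ A * b u v) (b := fun u v ↦ A * b u v)
    hAb hAb ha (fun u v w ↦ ?_) μ κ ν
  · exact htri.trans (add_le_add (wassLike_const_mul_le hA) (wassLike_const_mul_le hA))
  rw [← ENNReal.ofReal_add (mul_nonneg hA.le (hb0 _ _)) (mul_nonneg hA.le (hb0 _ _)), ← mul_add]
  exact ENNReal.ofReal_le_ofReal (h u v w)

variable {X : Type*} [MetricSpace X] [CompleteSpace X] [SecondCountableTopology X]
  [MeasurableSpace X] [BorelSpace X]

/-- If a kernel contracts `wassLike e` into the larger cost `wassLike d`, then truncated costs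
between the laws started from any two initial measures vanish along the iteration. -/
lemma tendsto_wassLike_min_iterate_bind {c d e : X → X → ℝ} (hc0 : ∀ u v, 0 ≤ c u v)
    (hc : LowerSemicontinuous fun p : X × X ↦ c p.1 p.2)
    (he : Measurable fun p : X × X ↦ e p.1 p.2)
    (hcd : ∀ u v, c u v ≤ d u v) (hed : ∀ u v, e u v ≤ d u v)
    {B : ℝ} (hB : 0 < B) {q : ℝ} (hq1 : q < 1) {P : X → Measure X}
    (hP : Measurable P) [∀ u, IsProbabilityMeasure (P u)]
    (hcontr : ∀ μ ν : Measure X, IsProbabilityMeasure μ → IsProbabilityMeasure ν →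
      wassLike d (μ.bind P) (ν.bind P) ≤ ENNReal.ofReal q * wassLike e μ ν)
    (μ ν : Measure X) [IsProbabilityMeasure μ] [IsProbabilityMeasure ν] (n : ℕ) :
    Tendsto (fun k ↦ wassLike (fun u v ↦ min (n : ℝ) (B * c u v))
      ((fun m : Measure X ↦ m.bind P)^[k] μ) ((fun m : Measure X ↦ m.bind P)^[k] ν))
      atTop (nhds 0) := by
  set T : Measure X → Measure X := fun m ↦ m.bind P
  have hTm (k : ℕ) : Measurable fun u ↦ T^[k] (Measure.dirac u) :=
    ((Measure.measurable_bind' hP).iterate k).comp Measure.measurable_dirac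
  have hTp (k : ℕ) (ξ : Measure X) [IsProbabilityMeasure ξ] : IsProbabilityMeasure (T^[k] ξ) :=
    isProbabilityMeasure_iterate_bind hP k ξ
  have hd (k : ℕ) (u v : X) : wassLike d (T^[k + 1] (Measure.dirac u)) (T^[k + 1] (Measure.dirac v))
      ≤ ENNReal.ofReal q ^ (k + 1) * ENNReal.ofReal (e u v) := by
    induction k with
    | zero =>
      rw [zero_add, pow_one, Function.iterate_one]
      exact (hcontr (.dirac u) (.dirac v) inferInstance inferInstance).trans
        (mul_le_mul_right (wassLike_dirac_le he u v) _)
    | succ k ih =>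
      rw [Function.iterate_succ_apply' T (k + 1) (.dirac u),
        Function.iterate_succ_apply' T (k + 1) (.dirac v), pow_succ', mul_assoc]
      exact (hcontr _ _ (hTp _ _) (hTp _ _)).trans
        (mul_le_mul_right ((wassLike_mono hed).trans ih) _)
  set F : ℕ → X × X → ℝ≥0∞ := fun k p ↦
    min (n : ℝ≥0∞) (ENNReal.ofReal B * (ENNReal.ofReal q ^ (k + 1) * ENNReal.ofReal (e p.1 p.2)))
    with hFdef
  have hF (k : ℕ) : Measurable (F k) :=
    measurable_const.min ((he.ennreal_ofReal.const_mul _).const_mul _)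
  have hmin0 (u v : X) : 0 ≤ min (n : ℝ) (B * c u v) :=
    le_min (Nat.cast_nonneg n) (mul_nonneg hB.le (hc0 u v))
  have hminlsc : LowerSemicontinuous fun p : X × X ↦ min (n : ℝ) (B * c p.1 p.2) := by
    have hcont : Continuous fun t : ℝ ↦ min (n : ℝ) (B * t) := by fun_prop
    have hmono : Monotone fun t : ℝ ↦ min (n : ℝ) (B * t) := fun s t hst ↦
      min_le_min_left _ (mul_le_mul_of_nonneg_left hst hB.le)
    exact hcont.comp_lowerSemicontinuous hc hmono
  have hpt (k : ℕ) (p : X × X) : wassLike (fun u v ↦ min (n : ℝ) (B * c u v))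
      (T^[k + 1] (Measure.dirac p.1)) (T^[k + 1] (Measure.dirac p.2)) ≤ F k p := by
    have := hTp (k + 1) (.dirac p.1)
    have := hTp (k + 1) (.dirac p.2)
    refine le_min ?_ ?_
    · rw [← ENNReal.ofReal_natCast]
      exact wassLike_le_of_le_const (fun u v ↦ min_le_left _ _) _ _
    · refine (wassLike_mono (d := fun u v ↦ B * c u v) fun u v ↦ min_le_right _ _).trans ?_
      refine (wassLike_const_mul_le hB).trans (mul_le_mul_right ?_ _)
      exact (wassLike_mono hcd).trans (hd k _ _)
  have hbound (k : ℕ) : wassLike (fun u v ↦ min (n : ℝ) (B * c u v)) (T^[k + 1] μ) (T^[k + 1] ν)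
      ≤ ∫⁻ p, F k p ∂(μ.prod ν) := by
    have h1 : (μ.prod ν).bind (fun p ↦ T^[k + 1] (Measure.dirac p.1)) = T^[k + 1] μ := by
      rw [← bind_map_eq_bind_comp (μ.prod ν) measurable_fst (hTm (k + 1)), Measure.map_fst_prod,
        measure_univ, one_smul]
      exact iterate_bind_dirac hP (k + 1) μ
    have h2 : (μ.prod ν).bind (fun p ↦ T^[k + 1] (Measure.dirac p.2)) = T^[k + 1] ν := by
      rw [← bind_map_eq_bind_comp (μ.prod ν) measurable_snd (hTm (k + 1)), Measure.map_snd_prod,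
        measure_univ, one_smul]
      exact iterate_bind_dirac hP (k + 1) ν
    have (p : X × X) := hTp (k + 1) (.dirac p.1)
    have (p : X × X) := hTp (k + 1) (.dirac p.2)
    have := wassLike_bind_le (c := fun u v ↦ min (n : ℝ) (B * c u v)) hmin0 hminlsc (μ.prod ν)
      (κ := fun p ↦ T^[k + 1] (Measure.dirac p.1)) (η := fun p ↦ T^[k + 1] (Measure.dirac p.2))
      ((hTm (k + 1)).comp measurable_fst) ((hTm (k + 1)).comp measurable_snd) (hF k) (hpt k)
    rwa [h1, h2] at this
  have hlim : Tendsto (fun k ↦ ∫⁻ p, F k p ∂(μ.prod ν)) atTop (nhds 0) := by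
    have := tendsto_lintegral_of_dominated_convergence (μ := μ.prod ν) (F := F) (f := fun _ ↦ 0)
      (fun _ ↦ (n : ℝ≥0∞)) hF (fun k ↦ Eventually.of_forall fun p ↦ min_le_left _ _) (by simp)
      (Eventually.of_forall fun p ↦ ?_)
    · simpa using this
    · have hpow : Tendsto (fun k ↦ ENNReal.ofReal q ^ (k + 1)) atTop (nhds 0) :=
        (tendsto_add_atTop_iff_nat 1).2
          (ENNReal.tendsto_pow_atTop_nhds_zero_of_lt_one (by simpa using hq1))
      have h0 : Tendsto (fun k ↦ ENNReal.ofReal B *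
          (ENNReal.ofReal q ^ (k + 1) * ENNReal.ofReal (e p.1 p.2))) atTop (nhds 0) := by
        simpa using ENNReal.Tendsto.const_mul
          (ENNReal.Tendsto.mul_const hpow (.inr ENNReal.ofReal_ne_top)) (.inr ENNReal.ofReal_ne_top)
      exact tendsto_of_tendsto_of_tendsto_of_le_of_le tendsto_const_nhds h0
        (fun _ ↦ zero_le) fun _ ↦ min_le_right _ _
  exact (tendsto_add_atTop_iff_nat 1).1
    (tendsto_of_tendsto_of_tendsto_of_le_of_le tendsto_const_nhds hlim (fun _ ↦ zero_le) hbound)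

/-- Perturbation of an invariant measure: if `μ` is invariant under a contracting kernel `P` and
`ν` is moved by `P` by at most `K`, then `μ` and `ν` are within a multiple of `K`. -/
lemma wassLike_invariant_le {c d e : X → X → ℝ} (hc0 : ∀ u v, 0 ≤ c u v) (hd0 : ∀ u v, 0 ≤ d u v)
    (he0 : ∀ u v, 0 ≤ e u v) (hcdiag : ∀ u, c u u = 0)
    (hc : LowerSemicontinuous fun p : X × X ↦ c p.1 p.2)
    (hd : LowerSemicontinuous fun p : X × X ↦ d p.1 p.2)
    (he : LowerSemicontinuous fun p : X × X ↦ e p.1 p.2)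
    (hec : ∀ u v, e u v ≤ c u v) (hcd : ∀ u v, c u v ≤ d u v)
    {A B : ℝ} (hA : 0 < A) (hB : 0 < B)
    (hcA : ∀ u v w, c u v ≤ A * (d u w + d w v)) (heB : ∀ u v w, e u v ≤ B * (c u w + c w v))
    {q : ℝ} (hq0 : 0 ≤ q) (hq1 : q < 1) (hqA : 2 * A * q ≤ 1) {P : X → Measure X}
    (hP : Measurable P) [∀ u, IsProbabilityMeasure (P u)]
    (hcontr : ∀ μ ν : Measure X, IsProbabilityMeasure μ → IsProbabilityMeasure ν →
      wassLike d (μ.bind P) (ν.bind P) ≤ ENNReal.ofReal q * wassLike e μ ν)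
    (μ ν : Measure X) [IsProbabilityMeasure μ] [IsProbabilityMeasure ν] (hμ : μ.bind P = μ)
    {K : ℝ≥0∞} (hK : wassLike d (ν.bind P) ν ≤ K) :
    wassLike c μ ν ≤ ENNReal.ofReal (A * (B + 1)) * K := by
  have hcm := hc.measurable
  have hdm := hd.measurable
  set T : Measure X → Measure X := fun m ↦ m.bind P
  have hTp (k : ℕ) : IsProbabilityMeasure (T^[k] ν) := isProbabilityMeasure_iterate_bind hP k ν
  have hTν : IsProbabilityMeasure (ν.bind P) := hTp 1
  have hq : ENNReal.ofReal q * ENNReal.ofReal (2 * A) ≤ 1 := by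
    rw [← ENNReal.ofReal_mul hq0, ENNReal.ofReal_le_one]
    linarith
  have hstay (k : ℕ) : wassLike c (T^[k] ν) ν ≤ ENNReal.ofReal (2 * A) * K := by
    induction k with
    | zero => simp [wassLike_self ν hcm fun u ↦ (hcdiag u).le]
    | succ k ih =>
      have := hTp (k + 1)
      refine (wassLike_le_mul_add hcm hdm hd0 hA hcA _ (ν.bind P) _).trans ?_
      have h1 : wassLike d (T^[k + 1] ν) (ν.bind P) ≤ K := by
        rw [Function.iterate_succ_apply']
        calc _ ≤ ENNReal.ofReal q * wassLike e (T^[k] ν) ν := hcontr _ _ (hTp k) inferInstance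
          _ ≤ ENNReal.ofReal q * (ENNReal.ofReal (2 * A) * K) := by
            gcongr
            exact (wassLike_mono hec).trans ih
          _ ≤ K := by
            rw [← mul_assoc]
            exact mul_le_of_le_one_left' hq
      calc _ ≤ ENNReal.ofReal A * (K + K) := by gcongr
        _ = ENNReal.ofReal (2 * A) * K := by
          rw [ENNReal.ofReal_mul zero_le_two, ENNReal.ofReal_ofNat]
          ring
  have hμT (k : ℕ) : T^[k] μ = μ := Function.iterate_fixed hμ k
  have hμν : wassLike e μ ν ≤ ENNReal.ofReal B * (ENNReal.ofReal (2 * A) * K) := by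
    refine wassLike_le_of_forall_lipschitz he0 he _ _ fun g n g0 ge gn gL ↦ ?_
    have hgm : Measurable fun p : X × X ↦ g p.1 p.2 := by
      have : LipschitzWith n fun p : X × X ↦ g p.1 p.2 :=
        LipschitzWith.of_le_add_mul _ fun p q ↦ by simpa using gL p q
      exact this.continuous.measurable
    have hk (k : ℕ) : wassLike g μ ν ≤
        wassLike (fun u v ↦ min (n : ℝ) (B * c u v)) (T^[k] μ) (T^[k] ν)
          + ENNReal.ofReal B * (ENNReal.ofReal (2 * A) * K) := by
      have := hTp k
      rw [hμT]
      have hBm : Measurable fun p : X × X ↦ B * c p.1 p.2 := hcm.const_mul B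
      refine (wassLike_triangle (a := fun u v ↦ min (n : ℝ) (B * c u v))
        (b := fun u v ↦ B * c u v) (c := g) (measurable_const.min hBm) hBm hgm
        (fun u v w ↦ ?_) μ (T^[k] ν) ν).trans ?_
      · have h1 := mul_nonneg hB.le (hc0 u w)
        have h2 := mul_nonneg hB.le (hc0 w v)
        rw [← ENNReal.ofReal_add (le_min (Nat.cast_nonneg n) h1) h2]
        refine ENNReal.ofReal_le_ofReal ?_
        rw [← min_add_add_right]
        refine le_min ((gn u v).trans (le_add_of_nonneg_right h2)) ?_
        rw [← mul_add]
        exact (ge u v).trans (heB u v w)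
      · gcongr
        exact (wassLike_const_mul_le hB).trans (mul_le_mul_right (hstay k) _)
    have hlim := (tendsto_wassLike_min_iterate_bind hc0 hc he.measurable hcd
      (fun u v ↦ (hec u v).trans (hcd u v)) hB hq1 hP hcontr μ ν n).add_const
      (ENNReal.ofReal B * (ENNReal.ofReal (2 * A) * K))
    rw [zero_add] at hlim
    exact ge_of_tendsto' hlim hk
  have h1 : wassLike d μ (ν.bind P) ≤ ENNReal.ofReal B * K := by
    calc wassLike d μ (ν.bind P) = wassLike d (μ.bind P) (ν.bind P) := by rw [hμ]
      _ ≤ ENNReal.ofReal q * (ENNReal.ofReal B * (ENNReal.ofReal (2 * A) * K)) :=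
        (hcontr _ _ inferInstance inferInstance).trans (mul_le_mul_right hμν _)
      _ = (ENNReal.ofReal q * ENNReal.ofReal (2 * A)) * (ENNReal.ofReal B * K) := by ring
      _ ≤ _ := mul_le_of_le_one_left' hq
  calc wassLike c μ ν
      ≤ ENNReal.ofReal A * (wassLike d μ (ν.bind P) + wassLike d (ν.bind P) ν) :=
        wassLike_le_mul_add hcm hdm hd0 hA hcA _ _ _
    _ ≤ ENNReal.ofReal A * (ENNReal.ofReal B * K + K) := by gcongr
    _ = ENNReal.ofReal (A * (B + 1)) * K := by
      rw [ENNReal.ofReal_mul hA.le, ENNReal.ofReal_add hB.le zero_le_one, ENNReal.ofReal_one]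
      ring

end Invariant

section ExpWeight

variable {X : Type*} [NormedAddCommGroup X]

lemma expWeight_nonneg (ρ : X → X → ℝ) (a : ℝ) (u v : X) : 0 ≤ expWeight ρ a u v := by
  unfold expWeight
  positivity

lemma expWeight_mono (ρ : X → X → ℝ) {a b : ℝ} (hab : a ≤ b) (u v : X) :
    expWeight ρ a u v ≤ expWeight ρ b u v := by
  unfold expWeight
  gcongr

lemma DistanceLike.expWeight_self {ρ : X → X → ℝ} (hρ : DistanceLike ρ) (a : ℝ) (u : X) :
    expWeight ρ a u u = 0 := by
  simp [expWeight, (hρ.2.2.2 u u).2 rfl]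

lemma DistanceLike.lowerSemicontinuous_expWeight {ρ : X → X → ℝ} (hρ : DistanceLike ρ) (a : ℝ) :
    LowerSemicontinuous fun p : X × X ↦ expWeight ρ a p.1 p.2 := by
  have hsqrt : LowerSemicontinuous fun p : X × X ↦ √(ρ p.1 p.2) :=
    Real.continuous_sqrt.comp_lowerSemicontinuous hρ.2.2.1 fun _ _ ↦ Real.sqrt_le_sqrt
  have hexp : Continuous fun p : X × X ↦ Real.exp (a * ‖p.1‖ ^ 2 + a * ‖p.2‖ ^ 2) := by fun_prop
  intro p y hy
  have hy' : y / Real.exp (a * ‖p.1‖ ^ 2 + a * ‖p.2‖ ^ 2) < √(ρ p.1 p.2) := by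
    rwa [div_lt_iff₀ (Real.exp_pos _)]
  obtain ⟨s, hs, hs'⟩ := exists_between hy'
  have h1 : ∀ᶠ p' : X × X in nhds p,
      y / Real.exp (a * ‖p'.1‖ ^ 2 + a * ‖p'.2‖ ^ 2) < s :=
    (continuous_const.div hexp fun _ ↦ (Real.exp_pos _).ne').continuousAt.eventually_lt_const hs
  filter_upwards [h1, hsqrt p s hs'] with p' h h'
  exact (div_lt_iff₀ (Real.exp_pos _)).1 (h.trans h')

end ExpWeight

/-- Theorem 2.3 (thm:gen:wk:conv): under (H1)-(H3), a finite-time error estimate for the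
family of Markov kernels yields a bound on the Wasserstein distance between the
invariant measures `μ_θ` and `μ_{θ₀}`. -/
theorem invariant_measure_bias_bound
    {X : Type*} [NormedAddCommGroup X] [NormedSpace ℝ X] [CompleteSpace X]
    [SecondCountableTopology X] [MeasurableSpace X] [BorelSpace X]
    {Θ : Type*} (θ₀ : Θ)
    (P : Θ → ℝ → X → Measure X)
    (hker : ∀ θ : Θ, ∀ t ≥ (0 : ℝ), IsMarkovKernelFun (P θ t))
    (Λ : Set (X → X → ℝ))
    (hΛ : ∀ ρ ∈ Λ, DistanceLike ρ ∧ ∀ u v : X, ρ u v ≤ 1)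
    -- (H1) generalized triangle inequality for the weighted distances
    (γ : ℝ) (hγ : 1 ≤ γ)
    (hH1 : ∀ ρ ∈ Λ, ∀ α > (0 : ℝ), ∃ C > (0 : ℝ), ∀ u v w : X,
      expWeight ρ α u v ≤ C * (expWeight ρ (γ * α) u w + expWeight ρ (γ * α) w v))
    -- (H2) invariant measures
    (μinv : Θ → Measure X) (hμprob : ∀ θ, IsProbabilityMeasure (μinv θ))
    (hH2 : ∀ θ : Θ, ∀ t ≥ (0 : ℝ), (μinv θ).bind (P θ t) = μinv θ)
    -- (H3) parameter-uniform Wasserstein contraction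
    (hH3 : ∀ m : ℝ, 1 ≤ m → ∃ αm > (0 : ℝ), ∀ α ∈ Set.Ioc (0 : ℝ) αm, ∃ ρ ∈ Λ,
      ∃ T > (0 : ℝ), ∃ C₁ > (0 : ℝ), ∃ C₂ > (0 : ℝ), ∀ θ : Θ, θ ≠ θ₀ → ∀ t ≥ T,
        ∀ μ ν : Measure X, IsProbabilityMeasure μ → IsProbabilityMeasure ν →
          wassLike (expWeight ρ α) (μ.bind (P θ t)) (ν.bind (P θ t))
            ≤ ENNReal.ofReal (C₁ * Real.exp (-C₂ * t))
              * wassLike (expWeight ρ (α / m)) μ ν) :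
    ∃ αs > (0 : ℝ), ∀ α ∈ Set.Ioc (0 : ℝ) αs, ∃ ρ ∈ Λ, ∃ Ttil > (0 : ℝ), ∃ C > (0 : ℝ),
      ∀ (g : Θ → ℝ) (φt : ℝ → ℝ) (f : X → ℝ≥0∞),
        (∀ θ, 0 ≤ g θ) → (∀ t ≥ (0 : ℝ), 0 ≤ φt t) → Measurable f →
        -- (H4) finite-time error estimate
        (∀ θ : Θ, ∀ t ≥ (0 : ℝ), ∀ u : X,
          wassLike (expWeight ρ (γ * α)) (P θ t u) (P θ₀ t u)
            ≤ ENNReal.ofReal (φt t) * f u * ENNReal.ofReal (g θ)) →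
        ∀ θ : Θ,
          wassLike (expWeight ρ α) (μinv θ) (μinv θ₀)
            ≤ ENNReal.ofReal (C * φt Ttil * g θ) * ∫⁻ u, f u ∂(μinv θ₀) := by
  obtain ⟨αm, hαm, hcontr⟩ := hH3 (γ ^ 2) (one_le_pow₀ hγ)
  have hγ0 : 0 < γ := zero_lt_one.trans_le hγ
  refine ⟨αm / γ, div_pos hαm hγ0, fun α hα ↦ ?_⟩
  have hα0 : 0 < α := hα.1
  obtain ⟨ρ, hρ, T, hT, C₁, hC₁, C₂, hC₂, hW⟩ := hcontr (γ * α)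
    ⟨mul_pos hγ0 hα0, by rw [mul_comm]; exact (le_div_iff₀ hγ0).1 hα.2⟩
  have hdist := (hΛ ρ hρ).1
  obtain ⟨A, hA, hcA⟩ := hH1 ρ hρ α hα0
  obtain ⟨B, hB, heB⟩ := hH1 ρ hρ (α / γ) (div_pos hα0 hγ0)
  rw [mul_div_cancel₀ _ hγ0.ne'] at heB
  have hα' : γ * α / γ ^ 2 = α / γ := by field_simp
  rw [hα'] at hW
  have hlim : Tendsto (fun t ↦ C₁ * Real.exp (-C₂ * t)) atTop (nhds 0) := by
    have : Tendsto (fun t ↦ -C₂ * t) atTop atBot :=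
      tendsto_id.const_mul_atTop_of_neg (neg_neg_of_pos hC₂)
    simpa using (Real.tendsto_exp_atBot.comp this).const_mul C₁
  obtain ⟨S, hST, hS1, hSA⟩ := ((eventually_ge_atTop T).and
    ((hlim.eventually_lt_const zero_lt_one).and
      (hlim.eventually_lt_const (show (0 : ℝ) < 1 / (2 * A) by positivity)))).exists
  have hS : 0 < S := hT.trans_le hST
  refine ⟨ρ, hρ, S, hS, A * (B + 1), by positivity, fun g φt f hg hφ hf hH4 θ ↦ ?_⟩
  have := hμprob θ
  have := hμprob θ₀
  rcases eq_or_ne θ θ₀ with rfl | hθ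
  · rw [wassLike_self _ (hdist.lowerSemicontinuous_expWeight α).measurable
      fun u ↦ (hdist.expWeight_self α u).le]
    exact zero_le
  have := (hker θ S hS.le).2
  have := (hker θ₀ S hS.le).2
  have hK : wassLike (expWeight ρ (γ * α)) ((μinv θ₀).bind (P θ S)) (μinv θ₀)
      ≤ ENNReal.ofReal (φt S) * (∫⁻ u, f u ∂(μinv θ₀)) * ENNReal.ofReal (g θ) := by
    have h := wassLike_bind_le (expWeight_nonneg ρ (γ * α))
      (hdist.lowerSemicontinuous_expWeight (γ * α)) (μinv θ₀) (hker θ S hS.le).1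
      (hker θ₀ S hS.le).1 ((hf.const_mul _).mul_const _) (hH4 θ S hS.le)
    rwa [hH2 θ₀ S hS.le, lintegral_mul_const _ (hf.const_mul _), lintegral_const_mul _ hf] at h
  refine (wassLike_invariant_le (expWeight_nonneg ρ α) (expWeight_nonneg ρ (γ * α))
    (expWeight_nonneg ρ (α / γ)) (hdist.expWeight_self α)
    (hdist.lowerSemicontinuous_expWeight α) (hdist.lowerSemicontinuous_expWeight (γ * α))
    (hdist.lowerSemicontinuous_expWeight (α / γ)) (expWeight_mono ρ (div_le_self hα0.le hγ))
    (expWeight_mono ρ (le_mul_of_one_le_left hα0.le hγ)) hA hB hcA heB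
    (mul_nonneg hC₁.le (Real.exp_pos _).le) hS1
    (by rw [mul_comm]; exact ((lt_div_iff₀ (by positivity)).1 hSA).le) (hker θ S hS.le).1
    (hW θ hθ S hST) (μinv θ) (μinv θ₀) (hH2 θ S hS.le) hK).trans_eq ?_
  rw [mul_assoc _ (φt S), ENNReal.ofReal_mul (p := A * (B + 1)) (by positivity),
    ENNReal.ofReal_mul (hφ S hS.le)]
  ring
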